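/- arXiv:1705.02641 — 3 statements merged into one kernel-verified Lean document; each statement's English description precedes it below -/
import Mathlib

section
/- (Proposition 3.1) The kernel of the reduced Burau representation ρ : B₄ → GL₃(ℤ[t,t⁻¹]) is contained in the kernel of the homomorphism φ : B₄ → B₃ determined by φ(σ₁) = σ₁, φ(σ₂) = σ₂, φ(σ₃) = σ₁; that is, if ρ(σ) = 1 then φ(σ) = 1. -/
open LaurentPolynomial Matrix

noncomputable section

/-- The ring of Laurent polynomials `ℤ[t,t⁻¹]`. -/
abbrev L := LaurentPolynomial ℤ

/-- Braid relations on `k` Artin generators (`σᵢσⱼσᵢ = σⱼσᵢσⱼ` for `|i−j| = 1`,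
`σᵢσⱼ = σⱼσᵢ` for `|i−j| > 1`). -/
def braidRels (k : ℕ) : Set (FreeGroup (Fin k)) :=
  {r | (∃ i j : Fin k, i.val + 1 = j.val ∧
        r = FreeGroup.of i * FreeGroup.of j * FreeGroup.of i *
            (FreeGroup.of j * FreeGroup.of i * FreeGroup.of j)⁻¹) ∨
       (∃ i j : Fin k, i.val + 1 < j.val ∧
        r = FreeGroup.of i * FreeGroup.of j * (FreeGroup.of j * FreeGroup.of i)⁻¹)}

/-- The braid group `B₄`, presented by `⟨σ₁,σ₂,σ₃ | σ₁σ₂σ₁=σ₂σ₁σ₂, σ₂σ₃σ₂=σ₃σ₂σ₃, σ₁σ₃=σ₃σ₁⟩`. -/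
abbrev B₄ := PresentedGroup (braidRels 3)

/-- The braid group `B₃`, presented by `⟨σ₁,σ₂ | σ₁σ₂σ₁=σ₂σ₁σ₂⟩`. -/
abbrev B₃ := PresentedGroup (braidRels 2)

/-- The Artin generators `σ₁, σ₂, σ₃` of `B₄` (zero-indexed). -/
def σ₄ (i : Fin 3) : B₄ := PresentedGroup.of i

/-- The Artin generators `σ₁, σ₂` of `B₃` (zero-indexed). -/
def σ₃ (i : Fin 2) : B₃ := PresentedGroup.of i

/-- The reduced Burau matrices of the Artin generators `σ₁, σ₂, σ₃` of `B₄`. -/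
def M : Fin 3 → Matrix (Fin 3) (Fin 3) L
  | 0 => !![-T (-1), 0, 0; T (-1), 1, 0; 0, 0, 1]
  | 1 => !![1, 1, 0; 0, -T (-1), 0; 0, T (-1), 1]
  | 2 => !![1, 0, 0; 0, 1, 1; 0, 0, -T (-1)]

/-- The first Bokut–Vesnin generator `a = σ₁σ₂σ₁⁻¹σ₃σ₂⁻¹σ₁⁻¹`. -/
def a : B₄ := σ₄ 0 * σ₄ 1 * (σ₄ 0)⁻¹ * σ₄ 2 * (σ₄ 1)⁻¹ * (σ₄ 0)⁻¹

/-- The second Bokut–Vesnin generator `b = σ₃σ₁⁻¹`. -/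
def b : B₄ := σ₄ 2 * (σ₄ 0)⁻¹

section BraidPair

variable {G : Type*} [Group G] {x y : G}

/-- In a group generated by a braided pair `x, y`, every element is a word in `x` and `y⁻¹`
multiplied by a power of `x * y * x` on the left and a power of `x * y` on the right. -/
lemma exists_zpow_mul_zpow_of_mem_closure (h : x * y * x = y * x * y) {g : G}
    (hg : g ∈ Subgroup.closure {x, y}) :
    ∃ (m n : ℤ), ∃ p ∈ Submonoid.closure {x, y⁻¹}, g = (x * y * x) ^ m * p * (x * y) ^ n := by
  set u := x * y * x with hu
  set v := x * y with hv
  have hv3 : v ^ 3 = u ^ 2 := by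
    simp only [pow_succ, pow_zero, one_mul, hu, hv, mul_assoc] at h ⊢; rw [h]
  have hcv : Commute (u ^ 2) v := hv3 ▸ Commute.pow_self v 3
  have hvu : v * u = u ^ 2 * y⁻¹ := by
    rw [eq_mul_inv_iff_mul_eq, sq]
    nth_rw 3 [h]
    simp only [hu, hv, mul_assoc]
  have hx_mem : x ∈ Submonoid.closure {x, y⁻¹} := Submonoid.subset_closure (by simp)
  have hy_mem : y⁻¹ ∈ Submonoid.closure {x, y⁻¹} := Submonoid.subset_closure (by simp)
  let S : Set G := {g | ∃ (m n : ℤ), ∃ p ∈ Submonoid.closure {x, y⁻¹}, g = u ^ m * p * v ^ n}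
  have hSu (k : ℤ) (g : G) : g ∈ S → u ^ k * g ∈ S := by
    rintro ⟨m, n, p, hp, rfl⟩
    exact ⟨k + m, n, p, hp, by rw [_root_.zpow_add]; group⟩
  have hSv (g : G) : g ∈ S → v * g ∈ S := by
    rintro ⟨m, n, p, hp, rfl⟩
    obtain ⟨k, hk⟩ := Int.even_or_odd' m
    have hc : v * u ^ (2 * k) = u ^ (2 * k) * v := by
      rw [_root_.zpow_mul]; exact mod_cast ((hcv.zpow_left k).eq).symm
    obtain rfl | rfl := hk
    · have key : v * (p * v ^ n) ∈ S := by
        induction hp using Submonoid.closure_induction_left with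
        | one => exact ⟨0, n + 1, 1, one_mem _, by rw [_root_.zpow_add]; group⟩
        | mul_left z hz q hq _ =>
          obtain rfl | rfl := hz
          · exact ⟨1, n, q, hq, by rw [hu]; group⟩
          · exact ⟨0, n, x * q, mul_mem hx_mem hq, by rw [hv]; group⟩
      have := hSu (2 * k) _ key
      rwa [← mul_assoc, ← hc, mul_assoc, ← mul_assoc (u ^ _)] at this
    · refine ⟨2 * k + 2, n, y⁻¹ * p, mul_mem hy_mem hp, ?_⟩
      calc v * (u ^ (2 * k + 1) * p * v ^ n) = v * u ^ (2 * k) * u * p * v ^ n := by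
            rw [_root_.zpow_add_one]; simp only [mul_assoc]
        _ = u ^ (2 * k) * (v * u) * p * v ^ n := by rw [hc]; simp only [mul_assoc]
        _ = u ^ (2 * k + 2) * (y⁻¹ * p) * v ^ n := by
            rw [hvu, _root_.zpow_add]; simp only [mul_assoc]; norm_cast
  have hSv' (g : G) (hg : g ∈ S) : v⁻¹ * g ∈ S := by
    have : v⁻¹ * g = u ^ (-2 : ℤ) * (v * (v * g)) := by
      have hu2 : u ^ (2 : ℤ) = v ^ (3 : ℤ) := mod_cast hv3.symm
      rw [_root_.zpow_neg, hu2]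
      group
    exact this ▸ hSu _ _ (hSv _ (hSv _ hg))
  have hxuv : x = v⁻¹ * u := by rw [hu]; group
  have hyuv : y = u * v⁻¹ := by rw [h, hv]; group
  change g ∈ S
  induction hg using Subgroup.closure_induction_left with
  | one => exact ⟨0, 0, 1, one_mem _, by simp⟩
  | mul_left z hz q _ hq =>
    obtain rfl | rfl := hz
    · rw [hxuv, mul_assoc]
      simpa using hSv' _ (hSu 1 _ hq)
    · rw [hyuv, mul_assoc]
      simpa using hSu 1 _ (hSv' _ hq)
  | inv_mul_cancel z hz q _ hq =>
    obtain rfl | rfl := hz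
    · rw [hxuv, _root_.mul_inv_rev, inv_inv, mul_assoc]
      simpa using hSu (-1) _ (hSv _ hq)
    · rw [hyuv, _root_.mul_inv_rev, inv_inv, mul_assoc]
      simpa using hSv _ (hSu (-1) _ hq)

end BraidPair

namespace B₃

lemma σ₃_braid : σ₃ 0 * σ₃ 1 * σ₃ 0 = σ₃ 1 * σ₃ 0 * σ₃ 1 := by
  rw [← mul_inv_eq_one]
  exact PresentedGroup.one_of_mem (Or.inl ⟨0, 1, rfl, rfl⟩)

lemma closure_σ₃ : Subgroup.closure {σ₃ 0, σ₃ 1} = ⊤ := by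
  rw [← PresentedGroup.closure_range_of, ← Set.image_univ]
  congr 1
  ext g
  simp [Fin.exists_fin_two, eq_comm, σ₃]

/-- The homomorphism from `B₃` determined by a braided pair. -/
def lift {G : Type*} [Group G] (f : Fin 2 → G) (h : f 0 * f 1 * f 0 = f 1 * f 0 * f 1) : B₃ →* G :=
  PresentedGroup.toGroup (f := f) <| by
    rintro _ (⟨i, j, hij, rfl⟩ | ⟨i, j, hij, rfl⟩)
    · obtain ⟨rfl, rfl⟩ : i = 0 ∧ j = 1 := by omega
      rw [map_mul, map_inv, mul_inv_eq_one]
      simpa using h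
    · omega

@[simp]
lemma lift_σ₃ {G : Type*} [Group G] (f : Fin 2 → G) (h : f 0 * f 1 * f 0 = f 1 * f 0 * f 1)
    (i : Fin 2) : lift f h (σ₃ i) = f i :=
  PresentedGroup.toGroup.of _

/-- The standard homomorphism from `B₃` to the group of invertible integral `2 × 2` matrices. -/
def toGL : B₃ →* GL (Fin 2) ℤ :=
  lift ![⟨!![1, 1; 0, 1], !![1, -1; 0, 1], by decide, by decide⟩,
    ⟨!![1, 0; -1, 1], !![1, 0; 1, 1], by decide, by decide⟩] (Units.ext (by decide))

/-- The homomorphism `B₃ → ℚˣ` mapping both generators to `-2`. -/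
def toUnits : B₃ →* ℚˣ :=
  lift (fun _ ↦ Units.mk0 (-2) (by norm_num)) rfl

lemma coe_toGL_σ₃_zero : (toGL (σ₃ 0) : Matrix (Fin 2) (Fin 2) ℤ) = !![1, 1; 0, 1] :=
  congrArg Units.val (lift_σ₃ _ _ 0)

lemma coe_toGL_σ₃_one : (toGL (σ₃ 1) : Matrix (Fin 2) (Fin 2) ℤ) = !![1, 0; -1, 1] :=
  congrArg Units.val (lift_σ₃ _ _ 1)

lemma coe_toGL_σ₃_one_inv :
    (toGL (σ₃ 1)⁻¹ : Matrix (Fin 2) (Fin 2) ℤ) = !![1, 0; 1, 1] := by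
  rw [map_inv, toGL, lift_σ₃]
  rfl

lemma toGL_nonneg {p : B₃} (hp : p ∈ Submonoid.closure {σ₃ 0, (σ₃ 1)⁻¹}) :
    p = 1 ∨ (1 ≤ toGL p 0 0 ∧ 1 ≤ toGL p 1 1 ∧ 0 ≤ toGL p 0 1 ∧ 0 ≤ toGL p 1 0 ∧
      1 ≤ toGL p 0 1 + toGL p 1 0) := by
  induction hp using Submonoid.closure_induction_left with
  | one => exact Or.inl rfl
  | mul_left z hz q _ hq =>
    right
    have hq' : 1 ≤ toGL q 0 0 ∧ 1 ≤ toGL q 1 1 ∧ 0 ≤ toGL q 0 1 ∧ 0 ≤ toGL q 1 0 := by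
      obtain rfl | hq := hq
      · simp
      · tauto
    obtain rfl | rfl := hz
    · rw [map_mul, Units.val_mul, coe_toGL_σ₃_zero]
      simp [Matrix.mul_apply]
      omega
    · rw [map_mul, Units.val_mul, coe_toGL_σ₃_one_inv]
      simp [Matrix.mul_apply]
      omega

/-- The homomorphism `B₃ → GL₂(ℤ) × ℚˣ` is injective. -/
lemma eq_one_of_toGL_of_toUnits {g : B₃} (h₁ : toGL g = 1) (h₂ : toUnits g = 1) : g = 1 := by
  obtain ⟨m, n, p, hp, rfl⟩ :=
    exists_zpow_mul_zpow_of_mem_closure σ₃_braid (closure_σ₃ ▸ Subgroup.mem_top g)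
  obtain rfl | hp := toGL_nonneg hp
  · have hmn : 3 * m + 2 * n = 0 := by
      have h : ((-2 : ℚ)) ^ (3 * m + 2 * n) = 1 := by
        have := congrArg Units.val h₂
        simp only [toUnits, map_mul, map_zpow, map_one, lift_σ₃, Units.val_mul,
          Units.val_zpow_eq_zpow_val, Units.val_mk0, Units.val_one] at this
        rw [zpow_add₀ (by norm_num), _root_.zpow_mul, _root_.zpow_mul, ← this]
        norm_num
      have := congrArg abs h
      rw [abs_zpow, abs_one, zpow_eq_one_iff_right₀ (by norm_num) (by norm_num)] at this
      exact this
    obtain ⟨j, rfl⟩ : ∃ j, m = 2 * j := ⟨m / 2, by omega⟩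
    obtain rfl : n = 3 * (-j) := by omega
    have hv : (σ₃ 0 * σ₃ 1) ^ (3 : ℤ) = (σ₃ 0 * σ₃ 1 * σ₃ 0) ^ (2 : ℤ) := by
      have h := σ₃_braid
      norm_cast
      simp only [pow_succ, pow_zero, one_mul, mul_assoc] at h ⊢; rw [h]
    rw [_root_.zpow_mul _ 2, _root_.zpow_mul _ 3, hv]
    group
  · exfalso
    rw [map_mul, map_mul, map_zpow, map_zpow, mul_assoc, ← eq_inv_mul_iff_mul_eq,
      ← eq_mul_inv_iff_mul_eq, mul_one, ← _root_.zpow_neg, ← _root_.zpow_neg] at h₁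
    have hu : (toGL (σ₃ 0 * σ₃ 1 * σ₃ 0) : Matrix (Fin 2) (Fin 2) ℤ) = !![0, 1; -1, 0] := by
      rw [map_mul, map_mul, Units.val_mul, Units.val_mul, coe_toGL_σ₃_zero, coe_toGL_σ₃_one]
      decide
    have hv : (toGL (σ₃ 0 * σ₃ 1) : Matrix (Fin 2) (Fin 2) ℤ) = !![0, 1; -1, 1] := by
      rw [map_mul, Units.val_mul, coe_toGL_σ₃_zero, coe_toGL_σ₃_one]
      decide
    generalize toGL (σ₃ 0 * σ₃ 1 * σ₃ 0) = u at *
    generalize toGL (σ₃ 0 * σ₃ 1) = v at *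
    have hu4 : u ^ 4 = 1 := Units.ext (by rw [Units.val_pow_eq_pow_val, hu]; decide)
    have hv6 : v ^ 6 = 1 := Units.ext (by rw [Units.val_pow_eq_pow_val, hv]; decide)
    have hu' (k : ℤ) : ∃ r < 4, u ^ k = u ^ r :=
      ⟨(k % 4).toNat, by omega, by
        rw [zpow_eq_zpow_emod k (n := 4) (mod_cast hu4), ← zpow_natCast]
        congr 1
        omega⟩
    have hv' (k : ℤ) : ∃ r < 6, v ^ k = v ^ r :=
      ⟨(k % 6).toNat, by omega, by
        rw [zpow_eq_zpow_emod k (n := 6) (mod_cast hv6), ← zpow_natCast]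
        congr 1
        omega⟩
    obtain ⟨r, hr, hur⟩ := hu' (-m)
    obtain ⟨s, hs, hvs⟩ := hv' (-n)
    rw [h₁, hur, hvs, Units.val_mul, Units.val_pow_eq_pow_val, Units.val_pow_eq_pow_val, hu,
      hv] at hp
    revert hp
    clear * - hr hs
    decide +revert

end B₃

/-- The specialization `t = -1`. -/
def evalNegOne : L →+* ℤ := LaurentPolynomial.eval₂ (RingHom.id ℤ) (-1)

/-- The specialization `t = 1/2`. -/
def evalHalf : L →+* ℚ :=
  LaurentPolynomial.eval₂ (Int.castRingHom ℚ) (Units.mk0 2⁻¹ (by norm_num))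

lemma evalNegOne_T : evalNegOne (T (-1)) = -1 := by
  rw [evalNegOne, eval₂_T]; simp

lemma evalHalf_T : evalHalf (T (-1)) = 2 := by
  rw [evalHalf, eval₂_T]; simp

/-- (Proposition 3.1) The kernel of the reduced Burau representation `ρ : B₄ → GL₃(ℤ[t,t⁻¹])`
is contained in the kernel of the homomorphism `φ : B₄ → B₃` with `φ(σ₁)=σ₁`, `φ(σ₂)=σ₂`,
`φ(σ₃)=σ₁`. -/
theorem ker_burau_subset_ker_phi
    (ρ : B₄ →* GL (Fin 3) L)
    (hρ : ∀ i : Fin 3, (ρ (σ₄ i) : Matrix (Fin 3) (Fin 3) L) = M i)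
    (φ : B₄ →* B₃)
    (hφ : φ (σ₄ 0) = σ₃ 0 ∧ φ (σ₄ 1) = σ₃ 1 ∧ φ (σ₄ 2) = σ₃ 0) :
    ∀ σ : B₄, ρ σ = 1 → φ σ = 1 := by
  obtain ⟨h0, h1, h2⟩ := hφ
  intro σ hσ
  refine B₃.eq_one_of_toGL_of_toUnits ?_ ?_
  · let E : Matrix (Fin 3) (Fin 2) ℤ := !![0, -1; 1, 0; 0, 1]
    have key (τ : B₄) : evalNegOne.mapMatrix (ρ τ : Matrix (Fin 3) (Fin 3) L) * E =
        E * (B₃.toGL (φ τ) : Matrix (Fin 2) (Fin 2) ℤ) := by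
      have hτ : τ ∈ Subgroup.closure (Set.range σ₄) := by
        have := PresentedGroup.closure_range_of (braidRels 3)
        exact this ▸ Subgroup.mem_top τ
      induction hτ using Subgroup.closure_induction with
      | mem _ h =>
        obtain ⟨i, rfl⟩ := h
        rw [hρ]
        fin_cases i
        · simp only [Fin.zero_eta, h0, B₃.coe_toGL_σ₃_zero]
          ext i j
          fin_cases i <;> fin_cases j <;>
            simp [M, E, Matrix.mul_apply, Fin.sum_univ_succ, evalNegOne_T]
        · simp only [Fin.mk_one, h1, B₃.coe_toGL_σ₃_one]
          ext i j
          fin_cases i <;> fin_cases j <;>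
            simp [M, E, Matrix.mul_apply, Fin.sum_univ_succ, evalNegOne_T]
        · simp only [Fin.reduceFinMk, h2, B₃.coe_toGL_σ₃_zero]
          ext i j
          fin_cases i <;> fin_cases j <;>
            simp [M, E, Matrix.mul_apply, Fin.sum_univ_succ, evalNegOne_T]
      | one => simp
      | mul τ₁ τ₂ _ _ ih₁ ih₂ =>
        rw [map_mul, map_mul, map_mul, Units.val_mul, map_mul, Units.val_mul,
          Matrix.mul_assoc, ih₂, ← Matrix.mul_assoc, ih₁, Matrix.mul_assoc]
      | inv τ _ ih =>
        have hA : evalNegOne.mapMatrix (ρ τ⁻¹ : Matrix (Fin 3) (Fin 3) L) *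
            evalNegOne.mapMatrix (ρ τ : Matrix (Fin 3) (Fin 3) L) = 1 := by
          rw [← map_mul, ← Units.val_mul, ← map_mul, inv_mul_cancel, map_one, Units.val_one,
            map_one]
        have hB : (B₃.toGL (φ τ) : Matrix (Fin 2) (Fin 2) ℤ) * (B₃.toGL (φ τ⁻¹)).val = 1 := by
          rw [← Units.val_mul, ← map_mul, ← map_mul, mul_inv_cancel, map_one, map_one,
            Units.val_one]
        calc _ = evalNegOne.mapMatrix (ρ τ⁻¹ : Matrix (Fin 3) (Fin 3) L) *
              (E * (B₃.toGL (φ τ)).val) * (B₃.toGL (φ τ⁻¹)).val := by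
              rw [Matrix.mul_assoc, Matrix.mul_assoc, hB, Matrix.mul_one]
          _ = _ := by rw [← ih, ← Matrix.mul_assoc, hA, Matrix.one_mul]
    let E' : Matrix (Fin 2) (Fin 3) ℤ := !![0, 1, 0; 0, 0, 1]
    have hE : E' * E = 1 := by decide
    have h := key σ
    rw [hσ, Units.val_one, map_one, Matrix.one_mul] at h
    apply Units.ext
    calc (B₃.toGL (φ σ) : Matrix (Fin 2) (Fin 2) ℤ)
        = E' * (E * (B₃.toGL (φ σ)).val) := by
          rw [← Matrix.mul_assoc, hE, Matrix.one_mul]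
      _ = 1 := by rw [← h, hE]
  · have key : (Units.map evalHalf.toMonoidHom).comp (GeneralLinearGroup.det.comp ρ) =
        B₃.toUnits.comp φ := by
      refine PresentedGroup.ext fun i ↦ Units.ext ?_
      change evalHalf (ρ (σ₄ i) : Matrix (Fin 3) (Fin 3) L).det = B₃.toUnits (φ (σ₄ i))
      rw [hρ]
      fin_cases i <;>
        simp [M, h0, h1, h2, B₃.toUnits, Matrix.det_fin_three, evalHalf_T]
    have h := DFunLike.congr_fun key σ
    simpa [hσ] using h.symm

end
end

section
/- (Corollary 3.2) Every element of the kernel of the reduced Burau representation ρ : B₄ → GL₃(ℤ[t,t⁻¹]) lies in the subgroup of B₄ generated by the Bokut–Vesnin generators a = σ₁σ₂σ₁⁻¹σ₃σ₂⁻¹σ₁⁻¹ and b = σ₃σ₁⁻¹; in particular every kernel element may be written as a word in a, b, a⁻¹, b⁻¹. -/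
open LaurentPolynomial Matrix

noncomputable section

section BraidPairs

variable {G : Type*} [Group G]

lemma conj_eq_of_braid {p q : G} (h : p * q * p = q * p * q) :
    q⁻¹ * p * q = p * q * p⁻¹ := by
  rw [mul_assoc, inv_mul_eq_iff_eq_mul, ← mul_assoc, eq_mul_inv_iff_mul_eq, ← mul_assoc, h]

lemma sigma_two_commute_a {s₁ s₂ s₃ : G} (h₁₂ : s₁ * s₂ * s₁ = s₂ * s₁ * s₂)
    (h₁₃ : s₁ * s₃ = s₃ * s₁) :
    s₂ * (s₁ * s₂ * s₁⁻¹ * s₃ * s₂⁻¹ * s₁⁻¹) * s₂⁻¹ =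
      s₁ * s₂ * s₁⁻¹ * s₃ * s₂⁻¹ * s₁⁻¹ := by
  have h : s₁ * s₂ * s₁ * s₂⁻¹ * s₁⁻¹ = s₂ := by rw [h₁₂]; group
  calc s₂ * (s₁ * s₂ * s₁⁻¹ * s₃ * s₂⁻¹ * s₁⁻¹) * s₂⁻¹
      = (s₂ * s₁ * s₂) * s₁⁻¹ * s₃ * s₂⁻¹ * s₁⁻¹ * s₂⁻¹ := by group
    _ = s₁ * s₂ * s₁⁻¹ * (s₁ * s₃) * s₂⁻¹ * s₁⁻¹ * s₂⁻¹ := by rw [← h₁₂]; group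
    _ = s₁ * s₂ * s₁⁻¹ * s₃ * (s₂⁻¹ * s₁⁻¹) * (s₁ * s₂ * s₁ * s₂⁻¹ * s₁⁻¹) * s₂⁻¹ := by
        rw [h₁₃]; group
    _ = _ := by rw [h]; group

lemma sigma_two_conj_b {s₁ s₂ s₃ : G} (h₁₂ : s₁ * s₂ * s₁ = s₂ * s₁ * s₂)
    (h₂₃ : s₂ * s₃ * s₂ = s₃ * s₂ * s₃) (h₁₃ : s₁ * s₃ = s₃ * s₁) :
    s₂ * (s₃ * s₁⁻¹) * s₂⁻¹ = s₃ * s₁⁻¹ * (s₁ * s₂ * s₁⁻¹ * s₃ * s₂⁻¹ * s₁⁻¹) := by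
  have h₁₃' : s₁⁻¹ * s₃ = s₃ * s₁⁻¹ := (show Commute s₁ s₃ from h₁₃).inv_left.eq
  calc s₂ * (s₃ * s₁⁻¹) * s₂⁻¹
      = s₂ * s₃ * s₁⁻¹ * (s₂⁻¹ * s₁ * s₂) * s₂⁻¹ * s₁⁻¹ := by group
    _ = (s₂ * s₃ * s₂) * s₁⁻¹ * s₂⁻¹ * s₁⁻¹ := by rw [conj_eq_of_braid h₁₂]; group
    _ = s₃ * s₂ * (s₃ * s₁⁻¹) * s₂⁻¹ * s₁⁻¹ := by rw [h₂₃]; group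
    _ = s₃ * s₂ * (s₁⁻¹ * s₃) * s₂⁻¹ * s₁⁻¹ := by rw [h₁₃']
    _ = _ := by group

lemma sigma_one_conj_a {s₁ s₂ s₃ : G} (h₁₂ : s₁ * s₂ * s₁ = s₂ * s₁ * s₂)
    (h₂₃ : s₂ * s₃ * s₂ = s₃ * s₂ * s₃) (h₁₃ : s₁ * s₃ = s₃ * s₁) :
    s₁ * (s₁ * s₂ * s₁⁻¹ * s₃ * s₂⁻¹ * s₁⁻¹) * s₁⁻¹ =
      (s₃ * s₁⁻¹)⁻¹ * (s₁ * s₂ * s₁⁻¹ * s₃ * s₂⁻¹ * s₁⁻¹) := by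
  have h₁₃' : s₁⁻¹ * s₃ = s₃ * s₁⁻¹ := (show Commute s₁ s₃ from h₁₃).inv_left.eq
  have h : (s₁⁻¹ * s₂ * s₁)⁻¹ = s₂ * s₁⁻¹ * s₂⁻¹ := by
    rw [conj_eq_of_braid h₁₂.symm]; group
  have key : s₁ * s₂ * s₁⁻¹ * s₃ * s₂⁻¹ * s₁⁻¹ * s₁ =
      s₃ * (s₁ * s₂ * s₁⁻¹ * s₃ * s₂⁻¹ * s₁⁻¹) := by
    calc s₁ * s₂ * s₁⁻¹ * s₃ * s₂⁻¹ * s₁⁻¹ * s₁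
        = s₁ * s₂ * (s₁⁻¹ * s₃) * s₂⁻¹ := by group
      _ = s₁ * s₂ * s₃ * (s₁⁻¹ * s₂ * s₁)⁻¹ * s₁⁻¹ := by rw [h₁₃']; group
      _ = s₁ * (s₂ * s₃ * s₂) * s₁⁻¹ * s₂⁻¹ * s₁⁻¹ := by rw [h]; group
      _ = (s₁ * s₃) * s₂ * (s₃ * s₁⁻¹) * s₂⁻¹ * s₁⁻¹ := by rw [h₂₃]; group
      _ = _ := by rw [h₁₃, ← h₁₃']; group
  rw [mul_inv_eq_iff_eq_mul, _root_.mul_inv_rev, inv_inv, mul_assoc (s₁ * s₃⁻¹), key]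
  group

/-- The submonoid generated by `p` and `q⁻¹`. -/
def altMonoid (p q : G) : Submonoid G := Submonoid.closure {p, q⁻¹}

lemma altMonoid_image {p q : G} (f : G →* Matrix (Fin 2) (Fin 2) ℤ)
    (hp : f p = !![1, 1; 0, 1]) (hq : f q⁻¹ = !![1, 0; 1, 1]) {m : G} (hm : m ∈ altMonoid p q) :
    1 ≤ f m 0 0 ∧ 0 ≤ f m 0 1 ∧ 0 ≤ f m 1 0 ∧ 1 ≤ f m 1 1 ∧
      (m = 1 ∨ 1 ≤ f m 0 1 + f m 1 0) := by
  induction hm using Submonoid.closure_induction_left with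
  | one => simp
  | mul_left x hx y hy ih =>
    obtain ⟨h1, h2, h3, h4, -⟩ := ih
    rcases hx with rfl | rfl
    · simp only [map_mul, hp, Matrix.mul_apply, Fin.sum_univ_two]
      simp
      omega
    · simp only [map_mul, hq, Matrix.mul_apply, Fin.sum_univ_two]
      simp
      omega

lemma exists_alternating_form {p q : G} (h : p * q * p = q * p * q)
    (hG : Subgroup.closure {p, q} = ⊤) (g : G) :
    ∃ k i : ℤ, ∃ m ∈ altMonoid p q,
      g = ((p * q) ^ 3) ^ k * m * (p * q) ^ i ∨
      g = ((p * q) ^ 3) ^ k * (p * q * p) * m * (p * q) ^ i := by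
  set y := p * q with hy
  set x := y * p with hx
  set z := y ^ 3 with hz
  have hx' : x = q * y := by rw [h, hy, mul_assoc]
  have hxz : x * x = z := by
    calc x * x = y * p * (q * y) := by rw [← hx, ← hx']
      _ = z := by rw [hz, hy, pow_succ, pow_two]; simp only [mul_assoc]
  have hxz' : x⁻¹ = z⁻¹ * x := by rw [← hxz]; group
  have hyz : Commute y z := Commute.self_pow y 3
  have hcx : Commute x z := by rw [← hxz]; exact (Commute.refl x).mul_right (Commute.refl x)
  have hp : p = y⁻¹ * x := by rw [hx]; group
  have hq : q⁻¹ = z⁻¹ * y * x := by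
    have : q⁻¹ = y * x⁻¹ := by rw [hx']; group
    rw [this, hxz', ← mul_assoc, hyz.inv_right.eq]
  let S : Set G := {g | ∃ k i : ℤ, ∃ m ∈ altMonoid p q,
      g = z ^ k * m * y ^ i ∨ g = z ^ k * x * m * y ^ i}
  have hpm : p ∈ altMonoid p q := Submonoid.subset_closure (by simp)
  have hqm : q⁻¹ ∈ altMonoid p q := Submonoid.subset_closure (by simp)
  have hSz : ∀ (k : ℤ), ∀ g ∈ S, z ^ k * g ∈ S := by
    rintro l g ⟨k, i, m, hm, rfl | rfl⟩
    · exact ⟨l + k, i, m, hm, .inl (by rw [_root_.zpow_add]; group)⟩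
    · exact ⟨l + k, i, m, hm, .inr (by rw [_root_.zpow_add]; group)⟩
  have hSx : ∀ g ∈ S, x * g ∈ S := by
    rintro g ⟨k, i, m, hm, rfl | rfl⟩
    · refine ⟨k, i, m, hm, .inr ?_⟩
      rw [← (hcx.zpow_right k).eq]; simp only [mul_assoc]
    · refine ⟨k + 1, i, m, hm, .inl ?_⟩
      simp only [← mul_assoc]
      rw [(hcx.zpow_right k).eq, mul_assoc (z ^ k) x x, hxz, _root_.zpow_add_one]
  have hSy : ∀ g ∈ S, y * g ∈ S := by
    rintro g ⟨k, i, m, hm, rfl | rfl⟩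
    · have : y * (z ^ k * m * y ^ i) = z ^ k * (y * m * y ^ i) := by
        simp only [← mul_assoc]; rw [(hyz.zpow_right k).eq]
      rw [this]
      apply hSz
      induction hm using Submonoid.closure_induction_left with
      | one => exact ⟨0, i + 1, 1, one_mem _, .inl (by rw [add_comm, _root_.zpow_add]; simp)⟩
      | mul_left w hw m hm _ =>
        rcases hw with rfl | rfl
        · exact ⟨0, i, m, hm, .inr (by rw [hx]; simp [mul_assoc])⟩
        · refine ⟨0, i, p * m, mul_mem hpm hm, .inl ?_⟩
          have : y * q⁻¹ = p := by rw [hy]; group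
          rw [← mul_assoc, this]; simp
    · refine ⟨k + 1, i, q⁻¹ * m, mul_mem hqm hm, .inl ?_⟩
      simp only [← mul_assoc]
      rw [(hyz.zpow_right k).eq, hq, _root_.zpow_add_one]
      group
  have hSxi : ∀ g ∈ S, x⁻¹ * g ∈ S := fun g hg ↦ by
    rw [hxz', mul_assoc]
    simpa using hSz (-1) _ (hSx _ hg)
  have hSyi : ∀ g ∈ S, y⁻¹ * g ∈ S := fun g hg ↦ by
    have : y⁻¹ * g = z ^ (-1 : ℤ) * (y * (y * g)) := by rw [hz]; group
    rw [this]
    exact hSz (-1) _ (hSy _ (hSy _ hg))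
  have hq' : q = x * y⁻¹ := by rw [hx']; group
  have hg : g ∈ Subgroup.closure {p, q} := hG ▸ Subgroup.mem_top g
  change g ∈ S
  induction hg using Subgroup.closure_induction_left with
  | one => exact ⟨0, 0, 1, one_mem _, .inl (by simp)⟩
  | mul_left w hw g _ ih =>
    rcases hw with rfl | rfl
    · rw [hp, mul_assoc]; exact hSyi _ (hSx _ ih)
    · rw [hq', mul_assoc]; exact hSx _ (hSyi _ ih)
  | inv_mul_cancel w hw g _ ih =>
    rcases hw with rfl | rfl
    · rw [hp, _root_.mul_inv_rev, inv_inv, mul_assoc]; exact hSxi _ (hSy _ ih)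
    · rw [hq', _root_.mul_inv_rev, inv_inv, mul_assoc]; exact hSy _ (hSxi _ ih)

lemma map_center_zpow {z : G} (f : G →* Matrix (Fin 2) (Fin 2) ℤ) (hz : f z = -1) (k : ℤ) :
    f (z ^ k) = 1 ∨ f (z ^ k) = -1 := by
  have hz' : f z⁻¹ = -1 := by
    have h : f z * f z⁻¹ = 1 := by rw [← map_mul, mul_inv_cancel, map_one]
    rw [hz, neg_one_mul] at h
    rw [← h, neg_neg]
  induction k using Int.induction_on with
  | zero => simp
  | succ n ih => rcases ih with ih | ih <;> rw [_root_.zpow_add_one, map_mul, ih, hz] <;> simp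
  | pred n ih => rcases ih with ih | ih <;> rw [_root_.zpow_sub_one, map_mul, ih, hz'] <;> simp

/-- An element of a group generated by a braid pair `p, q` is trivial as soon as it has exponent
sum zero and trivial image in `SL₂(ℤ)`. -/
lemma eq_one_of_map_eq_one {p q : G} (h : p * q * p = q * p * q)
    (hG : Subgroup.closure {p, q} = ⊤) (f : G →* Matrix (Fin 2) (Fin 2) ℤ)
    (hp : f p = !![1, 1; 0, 1]) (hq : f q = !![1, 0; -1, 1])
    (e : G →* Multiplicative ℤ) (ep : e p = .ofAdd 1) (eq : e q = .ofAdd 1)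
    {g : G} (hf : f g = 1) (he : e g = 1) : g = 1 := by
  have hq' : f q⁻¹ = !![1, 0; 1, 1] := by
    have h1 : f q⁻¹ * f q = 1 := by rw [← map_mul, inv_mul_cancel, map_one]
    calc f q⁻¹ = f q⁻¹ * (f q * !![1, 0; 1, 1]) := by
          rw [hq]; simp [← Matrix.one_fin_two]
      _ = _ := by rw [← mul_assoc, h1, one_mul]
  have hy : f (p * q) = !![0, 1; -1, 1] := by simp [hp, hq]
  have hx : f (p * q * p) = !![0, 1; -1, 0] := by rw [map_mul, hy, hp]; simp
  have hz : f ((p * q) ^ 3) = -1 := by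
    rw [map_pow, hy, pow_succ, pow_two]
    simp [Matrix.one_fin_two]
  obtain ⟨k, i, m, hm, hg⟩ := exists_alternating_form h hG g
  obtain ⟨r, l, hr, hi⟩ : ∃ r : ℕ, ∃ l : ℤ, r < 3 ∧ (p * q) ^ i = (p * q) ^ r * ((p * q) ^ 3) ^ l := by
    refine ⟨(i % 3).toNat, i / 3, by omega, ?_⟩
    rw [← zpow_natCast, ← zpow_natCast, ← _root_.zpow_mul, ← _root_.zpow_add]
    congr 1
    omega
  have hM := altMonoid_image f hp hq' hm
  have hfm : f m = !![f m 0 0, f m 0 1; f m 1 0, f m 1 1] := Matrix.eta_fin_two _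
  generalize f m 0 0 = α at *
  generalize f m 0 1 = β at *
  generalize f m 1 0 = γ at *
  generalize f m 1 1 = δ at *
  have key : m = 1 ∧ r = 0 ∧ g = ((p * q) ^ 3) ^ k * m * (p * q) ^ i := by
    rcases hg with hg | hg <;> rw [hg, hi] at hf <;> simp only [map_mul f, hfm] at hf <;>
    rcases map_center_zpow f hz k with hk | hk <;> rcases map_center_zpow f hz l with hl | hl <;>
    rw [hk, hl] at hf <;> interval_cases r <;>
    simp [hp, hq, pow_two, ← Matrix.ext_iff, Fin.forall_fin_two] at hf <;>
    first
    | (exfalso; omega)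
    | exact ⟨hM.2.2.2.2.resolve_right (by omega), rfl, hg⟩
  obtain ⟨rfl, rfl, hg⟩ := key
  have hg' : g = ((p * q) ^ 3) ^ (k + l) := by rw [hg, hi, _root_.zpow_add]; simp
  have hkl : k + l = 0 := by
    rw [hg', map_zpow, map_pow, map_mul, ep, eq, ← ofAdd_add, ← ofAdd_nsmul, ← ofAdd_zsmul,
      ofAdd_eq_one] at he
    simpa using he
  rw [hg', hkl, zpow_zero]

lemma mem_normalizer_closure {S : Set G} {s : G}
    (h : ∀ x ∈ S, s * x * s⁻¹ ∈ Subgroup.closure S)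
    (h' : ∀ x ∈ S, s⁻¹ * x * s ∈ Subgroup.closure S) :
    s ∈ Subgroup.normalizer (Subgroup.closure S : Set G) := by
  have key : ∀ t : G, (∀ x ∈ S, t * x * t⁻¹ ∈ Subgroup.closure S) →
      ∀ x ∈ Subgroup.closure S, t * x * t⁻¹ ∈ Subgroup.closure S := fun t ht x hx ↦ by
    have : Subgroup.closure S ≤ (Subgroup.closure S).comap (MulAut.conj t).toMonoidHom := by
      rw [Subgroup.closure_le]
      exact fun x hx ↦ by simpa using ht x hx
    simpa using this hx
  rw [Subgroup.mem_normalizer_iff]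
  refine fun x ↦ ⟨key s h x, fun hx ↦ ?_⟩
  have := key s⁻¹ (by simpa using h') _ hx
  rwa [show s⁻¹ * (s * x * s⁻¹) * s⁻¹⁻¹ = x by group] at this

end BraidPairs

lemma braid_four_rel_one_two : σ₄ 0 * σ₄ 1 * σ₄ 0 = σ₄ 1 * σ₄ 0 * σ₄ 1 := by
  rw [← mul_inv_eq_one]
  exact PresentedGroup.one_of_mem (.inl ⟨0, 1, rfl, rfl⟩)

lemma braid_four_rel_two_three : σ₄ 1 * σ₄ 2 * σ₄ 1 = σ₄ 2 * σ₄ 1 * σ₄ 2 := by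
  rw [← mul_inv_eq_one]
  exact PresentedGroup.one_of_mem (.inl ⟨1, 2, rfl, rfl⟩)

lemma braid_four_rel_one_three : σ₄ 0 * σ₄ 2 = σ₄ 2 * σ₄ 0 := by
  rw [← mul_inv_eq_one]
  exact PresentedGroup.one_of_mem (.inr ⟨0, 2, by decide, rfl⟩)

/-- The homomorphism out of `B₄` determined by the images of the Artin generators. -/
def braidFourLift {H : Type*} [Group H] (s : Fin 3 → H) (h₁₂ : s 0 * s 1 * s 0 = s 1 * s 0 * s 1)
    (h₂₃ : s 1 * s 2 * s 1 = s 2 * s 1 * s 2) (h₁₃ : s 0 * s 2 = s 2 * s 0) : B₄ →* H :=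
  PresentedGroup.toGroup (rels := braidRels 3) (f := s) (by
    rintro _ (⟨i, j, hij, rfl⟩ | ⟨i, j, hij, rfl⟩) <;> fin_cases i <;> fin_cases j <;>
      simp_all)

lemma braidFourLift_sigma {H : Type*} [Group H] (s : Fin 3 → H)
    (h₁₂ : s 0 * s 1 * s 0 = s 1 * s 0 * s 1) (h₂₃ : s 1 * s 2 * s 1 = s 2 * s 1 * s 2)
    (h₁₃ : s 0 * s 2 = s 2 * s 0) (i : Fin 3) : braidFourLift s h₁₂ h₂₃ h₁₃ (σ₄ i) = s i :=
  PresentedGroup.toGroup.of _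

lemma closure_range_sigma : Subgroup.closure (Set.range σ₄) = ⊤ :=
  PresentedGroup.closure_range_of _

lemma braid_four_hom_ext {H : Type*} [Group H] {f g : B₄ →* H} (h : ∀ i, f (σ₄ i) = g (σ₄ i)) :
    f = g :=
  PresentedGroup.ext h

lemma bokutVesnin_normal : (Subgroup.closure ({a, b} : Set B₄)).Normal := by
  have ha : a ∈ Subgroup.closure ({a, b} : Set B₄) := Subgroup.subset_closure (by simp)
  have hb : b ∈ Subgroup.closure ({a, b} : Set B₄) := Subgroup.subset_closure (by simp)
  have h1a : σ₄ 0 * a * (σ₄ 0)⁻¹ = b⁻¹ * a := sigma_one_conj_a braid_four_rel_one_two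
    braid_four_rel_two_three braid_four_rel_one_three
  have h1b : σ₄ 0 * b * (σ₄ 0)⁻¹ = b := by
    rw [b, ← mul_assoc, braid_four_rel_one_three]; group
  have h2a : σ₄ 1 * a * (σ₄ 1)⁻¹ = a :=
    sigma_two_commute_a braid_four_rel_one_two braid_four_rel_one_three
  have h2b : σ₄ 1 * b * (σ₄ 1)⁻¹ = b * a := sigma_two_conj_b braid_four_rel_one_two
    braid_four_rel_two_three braid_four_rel_one_three
  have conj_symm : ∀ {s x y : B₄}, s * x * s⁻¹ = y → s⁻¹ * y * s = x := by
    rintro s x y rfl; group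
  have h1b' := conj_symm h1b
  have h1a' : (σ₄ 0)⁻¹ * a * σ₄ 0 = b * a := by
    have : (σ₄ 0)⁻¹ * a * σ₄ 0 = ((σ₄ 0)⁻¹ * b * σ₄ 0) * ((σ₄ 0)⁻¹ * (b⁻¹ * a) * σ₄ 0) := by group
    rw [this, h1b', conj_symm h1a]
  have h2a' := conj_symm h2a
  have h2b' : (σ₄ 1)⁻¹ * b * σ₄ 1 = b * a⁻¹ := by
    have : (σ₄ 1)⁻¹ * b * σ₄ 1 = ((σ₄ 1)⁻¹ * (b * a) * σ₄ 1) * ((σ₄ 1)⁻¹ * a * σ₄ 1)⁻¹ := by group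
    rw [this, h2a', conj_symm h2b]
  have n1 : σ₄ 0 ∈ Subgroup.normalizer (Subgroup.closure ({a, b} : Set B₄) : Set B₄) := by
    apply mem_normalizer_closure <;> rintro x (rfl | rfl)
    · rw [h1a]; exact mul_mem (inv_mem hb) ha
    · rwa [h1b]
    · rw [h1a']; exact mul_mem hb ha
    · rwa [h1b']
  have n2 : σ₄ 1 ∈ Subgroup.normalizer (Subgroup.closure ({a, b} : Set B₄) : Set B₄) := by
    apply mem_normalizer_closure <;> rintro x (rfl | rfl)
    · rwa [h2a]
    · rw [h2b]; exact mul_mem hb ha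
    · rwa [h2a']
    · rw [h2b']; exact mul_mem hb (inv_mem ha)
  have n3 : σ₄ 2 ∈ Subgroup.normalizer (Subgroup.closure ({a, b} : Set B₄) : Set B₄) := by
    have : σ₄ 2 = b * σ₄ 0 := by rw [b]; group
    rw [this]
    exact mul_mem (Subgroup.le_normalizer hb) n1
  rw [← Subgroup.normalizer_eq_top_iff, eq_top_iff, ← closure_range_sigma, Subgroup.closure_le]
  rintro _ ⟨i, rfl⟩
  fin_cases i
  exacts [n1, n2, n3]

/-- The exponent sum `B₄ → ℤ`. -/
def exponentSum : B₄ →* Multiplicative ℤ :=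
  braidFourLift (fun _ ↦ .ofAdd 1) rfl rfl rfl

/-- The images of the Artin generators under the homomorphism `B₄ → B₃ → SL₂(ℤ)`. -/
def modularGen : Fin 3 → GL (Fin 2) ℤ
  | 1 => ⟨!![1, 1; 0, 1], !![1, -1; 0, 1], by simp [Matrix.one_fin_two], by simp [Matrix.one_fin_two]⟩
  | _ => ⟨!![1, 0; -1, 1], !![1, 0; 1, 1], by simp [Matrix.one_fin_two], by simp [Matrix.one_fin_two]⟩

/-- The homomorphism from `B₄` to `SL₂(ℤ)` factoring through `B₃`, which is a constituent of the
reduced Burau representation at `t = -1`. -/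
def toModular : B₄ →* GL (Fin 2) ℤ :=
  braidFourLift modularGen (Units.ext (by simp [modularGen])) (Units.ext (by simp [modularGen])) rfl

@[simp]
lemma toModular_sigma (i : Fin 3) : toModular (σ₄ i) = modularGen i :=
  braidFourLift_sigma _ _ _ _ i

@[simp]
lemma exponentSum_sigma (i : Fin 3) : exponentSum (σ₄ i) = .ofAdd 1 :=
  braidFourLift_sigma _ _ _ _ i

lemma bokutVesnin_le_ker {H : Type*} [Group H] {f : B₄ →* H} (h : f (σ₄ 2) = f (σ₄ 0)) :
    Subgroup.closure {a, b} ≤ f.ker := by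
  rw [Subgroup.closure_le]
  rintro _ (rfl | rfl) <;> simp [MonoidHom.mem_ker, a, b, h]

/-- The kernel of `B₄ → B₃ → SL₂(ℤ)` meets the elements of exponent sum zero only in the
Bokut–Vesnin subgroup. -/
lemma mem_bokutVesnin_of_toModular {σ : B₄} (hf : toModular σ = 1) (he : exponentSum σ = 1) :
    σ ∈ Subgroup.closure ({a, b} : Set B₄) := by
  have := bokutVesnin_normal
  let N := Subgroup.closure ({a, b} : Set B₄)
  let π : B₄ →* B₄ ⧸ N := QuotientGroup.mk' N
  have hπ : π (σ₄ 2) = π (σ₄ 0) := by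
    rw [← mul_inv_eq_one, ← map_inv, ← map_mul]
    exact (QuotientGroup.eq_one_iff _).2 (Subgroup.subset_closure (by simp [b]))
  have hG : Subgroup.closure {π (σ₄ 1), π (σ₄ 0)} = ⊤ := by
    rw [← Subgroup.map_top_of_surjective π (QuotientGroup.mk'_surjective N),
      ← closure_range_sigma, MonoidHom.map_closure]
    congr 1
    ext x
    simp [Fin.exists_fin_succ, hπ, eq_comm]
    tauto
  have h : π (σ₄ 1) * π (σ₄ 0) * π (σ₄ 1) = π (σ₄ 0) * π (σ₄ 1) * π (σ₄ 0) := by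
    simp only [← map_mul, braid_four_rel_one_two]
  refine (QuotientGroup.eq_one_iff σ).1 (eq_one_of_map_eq_one h hG
    (f := (Units.coeHom _).comp
      (QuotientGroup.lift N toModular (bokutVesnin_le_ker (by simp [modularGen]))))
    (e := QuotientGroup.lift N exponentSum (bokutVesnin_le_ker (by simp)))
    ?_ ?_ ?_ ?_ ?_ ?_)
  all_goals simp [π, modularGen, hf, he]

lemma exponentSum_eq_one_of_burau (ρ : B₄ →* GL (Fin 3) L)
    (hρ : ∀ i : Fin 3, (ρ (σ₄ i) : Matrix (Fin 3) (Fin 3) L) = M i) {σ : B₄} (hσ : ρ σ = 1) :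
    exponentSum σ = 1 := by
  let ev : L →+* ℚ := LaurentPolynomial.eval₂ (Int.castRingHom ℚ) (Units.mk0 2⁻¹ (by norm_num))
  have h : (Units.map ev.toMonoidHom).comp (GeneralLinearGroup.det.comp ρ) =
      (zpowersHom ℚˣ (Units.mk0 (-2) (by norm_num))).comp exponentSum := by
    refine braid_four_hom_ext fun i ↦ ?_
    ext
    simp [hρ, ev]
    fin_cases i <;> simp [M, det_fin_three]
  have h' := congrArg Units.val (DFunLike.congr_fun h σ)
  simp [hσ] at h'
  have habs := congrArg abs h'
  rw [abs_zpow, abs_neg, abs_one, eq_comm, abs_two,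
    zpow_eq_one_iff_right₀ (by norm_num) (by norm_num)] at habs
  exact habs

lemma toModular_eq_one_of_burau (ρ : B₄ →* GL (Fin 3) L)
    (hρ : ∀ i : Fin 3, (ρ (σ₄ i) : Matrix (Fin 3) (Fin 3) L) = M i) {σ : B₄} (hσ : ρ σ = 1) :
    toModular σ = 1 := by
  let ev : L →+* ℤ := LaurentPolynomial.eval₂ (RingHom.id ℤ) (-1)
  let P : Matrix (Fin 3) (Fin 2) ℤ := !![1, 0; 0, 1; -1, 0]
  let r : B₄ →* GL (Fin 3) ℤ := (GeneralLinearGroup.map ev).comp ρ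
  have key : ∀ τ : B₄, (r τ).val * P = P * (toModular τ).val := by
    intro τ
    have hτ : τ ∈ Subgroup.closure (Set.range σ₄) := closure_range_sigma ▸ Subgroup.mem_top τ
    induction hτ using Subgroup.closure_induction with
    | mem x hx =>
      obtain ⟨i, rfl⟩ := hx
      have : (r (σ₄ i)).val = (M i).map ev := by
        rw [← hρ i]; rfl
      rw [this]
      fin_cases i <;> ext j k <;> fin_cases j <;> fin_cases k <;>
        simp [M, P, ev, modularGen, Matrix.mul_apply, Fin.sum_univ_three]
    | one => simp
    | mul x y _ _ hx hy =>
      simp only [map_mul, Units.val_mul]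
      rw [Matrix.mul_assoc, hy, ← Matrix.mul_assoc, hx, Matrix.mul_assoc]
    | inv x _ hx =>
      have h₁ : (r x⁻¹).val * (r x).val = 1 := by
        rw [← Units.val_mul, ← map_mul, inv_mul_cancel, map_one, Units.val_one]
      have h₂ : (toModular x).val * (toModular x⁻¹).val = 1 := by
        rw [← Units.val_mul, ← map_mul, mul_inv_cancel, map_one, Units.val_one]
      calc (r x⁻¹).val * P
          = (r x⁻¹).val * (P * (toModular x).val) *
              (toModular x⁻¹).val := by
            rw [Matrix.mul_assoc, Matrix.mul_assoc, h₂, Matrix.mul_one]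
        _ = P * (toModular x⁻¹).val := by
            rw [← hx, ← Matrix.mul_assoc, h₁, Matrix.one_mul]
  let Q : Matrix (Fin 2) (Fin 3) ℤ := !![1, 0, 0; 0, 1, 0]
  have h := congrArg (Q * ·) (key σ)
  have hP : Q * P = 1 := by simp [P, Q, Matrix.one_fin_two]
  have hr : r σ = 1 := by simp [r, hσ]
  simp only [hr, Units.val_one, Matrix.one_mul, ← Matrix.mul_assoc, hP] at h
  exact Units.ext h.symm

/-- (Corollary 3.2) Every element of the kernel of the reduced Burau representation lies in
the subgroup of `B₄` generated by the Bokut–Vesnin generators `a` and `b`. -/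
theorem ker_burau_subset_closure_bokutVesnin
    (ρ : B₄ →* GL (Fin 3) L)
    (hρ : ∀ i : Fin 3, (ρ (σ₄ i) : Matrix (Fin 3) (Fin 3) L) = M i) :
    ∀ σ : B₄, ρ σ = 1 → σ ∈ Subgroup.closure ({a, b} : Set B₄) := by
  exact fun σ hσ ↦ mem_bokutVesnin_of_toModular (toModular_eq_one_of_burau ρ hρ hσ)
    (exponentSum_eq_one_of_burau ρ hρ hσ)

end
end

section
/- (Lemma 4.1) For each braid σ ∈ B₄ there exist n ∈ ℕ and Laurent polynomials P, Q, R ∈ ℤ[t,t⁻¹] such that for every m ∈ ℕ: ρ₁₁(a^{n+m}σ) = P·S_{m+1}(t⁻¹) + Q + R·S_{m+1}(t) and ρ₃₁(a^{n+m}σ) = −P·S_m(t⁻¹) − Q − R·S_m(t) (in particular, for m = 0, ρ₁₁(aⁿσ) = P(1−t⁻¹) + Q + R(1−t) and ρ₃₁(aⁿσ) = −P − Q − R). Moreover, if σ is a pure braid then P ≠ 0. -/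
open LaurentPolynomial Matrix

noncomputable section

/-- `S m x = ∑_{k=0}^{m} (−x)^k`, the `m`-th partial sum of the geometric series with
initial term `1` and ratio `−x`. -/
def S (m : ℕ) (x : L) : L := ∑ k ∈ Finset.range (m + 1), (-x) ^ k

/-- The Burau matrix of `a`. -/
def burauA : Matrix (Fin 3) (Fin 3) L :=
  !![1 - T (-1), T 1 - T (-1), -T (-1); 0, -T 1, 0; -1, 0, 0]

/-- Evaluation of Laurent polynomials at `t = 1`. -/
def evalOne : L →+* ℤ := LaurentPolynomial.eval₂ (RingHom.id ℤ) 1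

/-- The images in `ℤ³` of the standard basis of `ℤ⁴` under the quotient by `(1,1,1,1)`,
in the basis for which the Burau representation at `t = 1` permutes them. -/
def permVec : Fin 4 → Fin 3 → ℤ := ![![1, 0, 0], ![-1, 1, 0], ![0, -1, 1], ![0, 0, -1]]

lemma T_one_mul_T_neg_one : (T 1 * T (-1) : L) = 1 := by
  rw [← T_add]; simp

lemma evalOne_T (n : ℤ) : evalOne (T n) = 1 := by
  simp [evalOne]

lemma S_succ (m : ℕ) (x : L) : S (m + 1) x = 1 - x * S m x := by
  rw [S, Finset.sum_range_succ', S, Finset.mul_sum]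
  simp only [pow_succ', pow_zero, neg_mul, Finset.sum_neg_distrib]
  ring

lemma S_zero (x : L) : S 0 x = 1 := by
  simp [S]

lemma burau_a (ρ : B₄ →* GL (Fin 3) L)
    (hρ : ∀ i : Fin 3, (ρ (σ₄ i) : Matrix (Fin 3) (Fin 3) L) = M i) :
    (ρ a : Matrix (Fin 3) (Fin 3) L) = burauA := by
  have h : (T (-1) * T 1 : L) = 1 := by rw [mul_comm, T_one_mul_T_neg_one]
  have h0 : ((ρ (σ₄ 0))⁻¹ : GL (Fin 3) L).val =
      !![-T 1, 0, 0; 1, 1, 0; 0, 0, 1] := by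
    apply Units.inv_eq_of_mul_eq_one_right
    rw [hρ]
    simp only [M]
    generalize (T 1 : L) = t, (T (-1) : L) = u at h
    refine Matrix.ext fun i j => ?_
    fin_cases i <;> fin_cases j <;> simp [Matrix.mul_apply, Fin.sum_univ_three, h]
  have h1 : ((ρ (σ₄ 1))⁻¹ : GL (Fin 3) L).val =
      !![1, T 1, 0; 0, -T 1, 0; 0, 1, 1] := by
    apply Units.inv_eq_of_mul_eq_one_right
    rw [hρ]
    simp only [M]
    generalize (T 1 : L) = t, (T (-1) : L) = u at h
    refine Matrix.ext fun i j => ?_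
    fin_cases i <;> fin_cases j <;> simp [Matrix.mul_apply, Fin.sum_univ_three, h]
  simp only [a, map_mul, map_inv, Units.val_mul, h0, h1, hρ, M, burauA]
  generalize (T 1 : L) = t, (T (-1) : L) = u at h
  refine Matrix.ext fun i j => ?_
  fin_cases i <;> fin_cases j <;> simp [Matrix.mul_apply, Fin.sum_univ_three, h] <;> grind

lemma one_add_mul_S (m : ℕ) (x : L) : (1 + x) * S m x = 1 - (-x) ^ (m + 1) := by
  have h := S_succ m x
  rw [S, Finset.sum_range_succ, ← S] at h
  linear_combination h

/-- The first column of the Burau matrix of `a ^ m * σ`. -/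
lemma burau_a_pow_mul (ρ : B₄ →* GL (Fin 3) L)
    (hρ : ∀ i : Fin 3, (ρ (σ₄ i) : Matrix (Fin 3) (Fin 3) L) = M i) (σ : B₄) (m : ℕ) :
    let r : Fin 3 → L := fun i => (ρ σ : Matrix (Fin 3) (Fin 3) L) i 0
    let P : L := -T 1 * (r 0 + r 1 + r 2)
    let Q : L := T 1 * (r 0 + r 1 + r 2) - T (-1) * r 1 - r 2
    let R : L := T (-1) * r 1
    (ρ (a ^ m * σ) : Matrix (Fin 3) (Fin 3) L) 1 0 = (-T 1) ^ m * r 1 ∧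
    (ρ (a ^ m * σ) : Matrix (Fin 3) (Fin 3) L) 0 0 =
      P * S (m + 1) (T (-1)) + Q + R * S (m + 1) (T 1) ∧
    (ρ (a ^ m * σ) : Matrix (Fin 3) (Fin 3) L) 2 0 =
      -(P * S m (T (-1))) - Q - R * S m (T 1) := by
  intro r P Q R
  have ht := T_one_mul_T_neg_one
  induction m with
  | zero =>
    simp only [pow_zero, one_mul, S_succ, S_zero, P, Q, R, r]
    refine ⟨trivial, ?_, ?_⟩
    · linear_combination (-r 0 - r 2) * ht
    · ring
  | succ m ih =>
    obtain ⟨ih1, ih0, ih2⟩ := ih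
    have hstep : (ρ (a ^ (m + 1) * σ) : Matrix (Fin 3) (Fin 3) L) =
        burauA * (ρ (a ^ m * σ) : Matrix (Fin 3) (Fin 3) L) := by
      rw [pow_succ', mul_assoc, map_mul, Units.val_mul, burau_a ρ hρ]
    have hgeo := one_add_mul_S m (T 1)
    simp only [hstep, burauA, Matrix.mul_apply, Fin.sum_univ_three, ih0, ih1, ih2, S_succ,
      Matrix.of_apply, Matrix.cons_val]
    refine ⟨by ring, ?_, by ring⟩
    linear_combination -(R * (T 1 - T (-1))) * hgeo -
      ((T 1 - T (-1)) * (-T 1) ^ m * r 1) * ht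

lemma burau_one_permVec (ρ : B₄ →* GL (Fin 3) L)
    (hρ : ∀ i : Fin 3, (ρ (σ₄ i) : Matrix (Fin 3) (Fin 3) L) = M i)
    (π : B₄ →* Equiv.Perm (Fin 4))
    (hπ : ∀ i : Fin 3, π (σ₄ i) = Equiv.swap i.castSucc i.succ) (σ : B₄) (j : Fin 4) :
    (ρ σ : Matrix (Fin 3) (Fin 3) L).map evalOne *ᵥ permVec j = permVec (π σ j) := by
  have hσ : σ ∈ Subgroup.closure (Set.range (PresentedGroup.of (rels := braidRels 3))) := by
    rw [PresentedGroup.closure_range_of]; trivial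
  induction hσ using Subgroup.closure_induction generalizing j with
  | mem x hx =>
    obtain ⟨i, rfl⟩ := hx
    change (ρ (σ₄ i) : Matrix (Fin 3) (Fin 3) L).map evalOne *ᵥ permVec j =
      permVec (π (σ₄ i) j)
    rw [hρ, hπ]
    have hM : (M i).map evalOne = (![!![-1, 0, 0; 1, 1, 0; 0, 0, 1],
        !![1, 1, 0; 0, -1, 0; 0, 1, 1], !![1, 0, 0; 0, 1, 1; 0, 0, -1]] :
          Fin 3 → Matrix (Fin 3) (Fin 3) ℤ) i := by
      ext k l
      fin_cases i <;> fin_cases k <;> fin_cases l <;> simp [M, evalOne_T]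
    rw [hM]
    clear hM
    revert i j
    decide
  | one => simp
  | mul x y _ _ hx hy =>
    rw [map_mul, map_mul, Units.val_mul, Matrix.map_mul, ← Matrix.mulVec_mulVec, hy, hx,
      Equiv.Perm.mul_apply]
  | inv x _ hx =>
    obtain ⟨k, rfl⟩ := (π x).surjective j
    rw [← hx, Matrix.mulVec_mulVec, ← Matrix.map_mul, ← Units.val_mul, map_inv, map_inv,
      inv_mul_cancel]
    simp

lemma sum_burau_ne_zero (ρ : B₄ →* GL (Fin 3) L)
    (hρ : ∀ i : Fin 3, (ρ (σ₄ i) : Matrix (Fin 3) (Fin 3) L) = M i)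
    (π : B₄ →* Equiv.Perm (Fin 4))
    (hπ : ∀ i : Fin 3, π (σ₄ i) = Equiv.swap i.castSucc i.succ) (σ : B₄) (hσ : π σ = 1) :
    (∑ i, (ρ σ : Matrix (Fin 3) (Fin 3) L) i 0) ≠ 0 := by
  intro h
  have hv := burau_one_permVec ρ hρ π hπ σ 0
  have hs := congrArg evalOne h
  rw [hσ] at hv
  have h0 := congrFun hv 0
  have h1 := congrFun hv 1
  have h2 := congrFun hv 2
  simp [permVec, Matrix.mulVec, dotProduct, Fin.sum_univ_three] at h0 h1 h2
  simp [Fin.sum_univ_three, h0, h1, h2] at hs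

/-- (Lemma 4.1) For each braid `σ ∈ B₄` there exist `n ∈ ℕ` and Laurent polynomials
`P, Q, R` such that for every `m ∈ ℕ`,
`ρ₁₁(a^{n+m}σ) = P·S_{m+1}(t⁻¹) + Q + R·S_{m+1}(t)` and
`ρ₃₁(a^{n+m}σ) = −P·S_m(t⁻¹) − Q − R·S_m(t)`; moreover, if `σ` is a pure braid
then `P ≠ 0`. -/
theorem burau_decomposition
    (ρ : B₄ →* GL (Fin 3) L)
    (hρ : ∀ i : Fin 3, (ρ (σ₄ i) : Matrix (Fin 3) (Fin 3) L) = M i)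
    (π : B₄ →* Equiv.Perm (Fin 4))
    (hπ : ∀ i : Fin 3, π (σ₄ i) = Equiv.swap i.castSucc i.succ) :
    ∀ σ : B₄, ∃ n : ℕ, ∃ P Q R : L,
      (∀ m : ℕ,
        (ρ (a ^ (n + m) * σ) : Matrix (Fin 3) (Fin 3) L) 0 0 =
          P * S (m + 1) (T (-1)) + Q + R * S (m + 1) (T 1) ∧
        (ρ (a ^ (n + m) * σ) : Matrix (Fin 3) (Fin 3) L) 2 0 =
          -(P * S m (T (-1))) - Q - R * S m (T 1)) ∧
      (π σ = 1 → P ≠ 0) := by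
  intro σ
  have ht := T_one_mul_T_neg_one
  set r : Fin 3 → L := fun i => (ρ σ : Matrix (Fin 3) (Fin 3) L) i 0
  refine ⟨0, -T 1 * (r 0 + r 1 + r 2), T 1 * (r 0 + r 1 + r 2) - T (-1) * r 1 - r 2,
    T (-1) * r 1, fun m => ?_, fun hσ hP => ?_⟩
  · rw [zero_add]
    exact (burau_a_pow_mul ρ hρ σ m).2
  · refine sum_burau_ne_zero ρ hρ π hπ σ hσ ?_
    rw [Fin.sum_univ_three]
    change r 0 + r 1 + r 2 = 0
    linear_combination -T (-1) * hP - (r 0 + r 1 + r 2) * ht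

end
end
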